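/- arXiv:2605.14376 — 6 statements merged into one kernel-verified Lean document; each statement's English description precedes it below -/
import Mathlib

section
/- Let G be a finite simple graph on n vertices, let c ≥ 1 and φ₀ > 0 be reals, and assume every vertex of G has at least one spreading component (with parameters c and φ₀). Then there exist vertices v_1, …, v_j with j ≤ ⌊c⌋ such that the kernels K(v_1), …, K(v_j) are pairwise disjoint and the sunflowers of v_1, …, v_j together cover all of V. -/
open Finset

variable {V : Type*}

/-- The degree of `v` inside the induced subgraph `G[S]`:
the number of neighbors of `v` (in `G`) lying in `S`. -/
def degIn (G : SimpleGraph V) [DecidableEq V] [DecidableRel G.Adj]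
    (S : Finset V) (v : V) : ℕ :=
  (S.filter (fun u => G.Adj v u)).card

/-- The volume of `U` inside the induced subgraph `G[S]`. -/
def volIn (G : SimpleGraph V) [DecidableEq V] [DecidableRel G.Adj]
    (S U : Finset V) : ℕ :=
  ∑ v ∈ U, degIn G S v

/-- The number of edges of the induced subgraph `G[S]` with one endpoint
in `U` and the other in `S \ U`. -/
def cutIn (G : SimpleGraph V) [DecidableEq V] [DecidableRel G.Adj]
    (S U : Finset V) : ℕ :=
  ((U ×ˢ (S \ U)).filter (fun p => G.Adj p.1 p.2)).card

/-- The conductance of the cut `(U, S \ U)` computed within the induced subgraph `G[S]`. -/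
noncomputable def phiIn (G : SimpleGraph V) [DecidableEq V] [DecidableRel G.Adj]
    (S U : Finset V) : ℝ :=
  (cutIn G S U : ℝ) / ((min (volIn G S U) (volIn G S (S \ U)) : ℕ) : ℝ)

/-- The conductance `Φ(G)`: the minimum of `φ_G(U)` over nonempty proper `U ⊊ V`. -/
noncomputable def conductance (G : SimpleGraph V) [Fintype V] [DecidableEq V]
    [DecidableRel G.Adj] : ℝ :=
  sInf {x : ℝ | ∃ U : Finset V, U.Nonempty ∧ U ⊂ Finset.univ ∧ x = phiIn G Finset.univ U}

/-- The weak conductance `Φ_c(G)`: min over vertices `v` of the max, over sets `S ∋ v`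
with `|S| ≥ n/c`, of the min over nonempty proper `U ⊊ S` of `φ_{G[S]}(U)`. -/
noncomputable def weakConductance (G : SimpleGraph V) [Fintype V] [DecidableEq V]
    [DecidableRel G.Adj] (c : ℝ) : ℝ :=
  ⨅ v : V, ⨆ (S : Finset V) (_ : v ∈ S ∧ (Fintype.card V : ℝ) / c ≤ (S.card : ℝ)),
    ⨅ (U : Finset V) (_ : U.Nonempty ∧ U ⊂ S), phiIn G S U

/-- `S` is a spreading component for `v` (with parameters `c` and `φ₀`):
`v ∈ S`, `|S| ≥ n/c`, the induced subgraph `G[S]` is connected, and every nonempty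
proper cut of `G[S]` has conductance at least `φ₀`. -/
def IsSpreadingComponent (G : SimpleGraph V) [Fintype V] [DecidableEq V] [DecidableRel G.Adj]
    (c φ₀ : ℝ) (v : V) (S : Finset V) : Prop :=
  v ∈ S ∧ (Fintype.card V : ℝ) / c ≤ (S.card : ℝ) ∧ (G.induce (S : Set V)).Connected ∧
    ∀ U : Finset V, U.Nonempty → U ⊂ S → φ₀ ≤ phiIn G S U

/-- A spreading component is maximal if it is not properly contained in any spreading
component for any vertex. -/
def IsMaximalSpreadingComponent (G : SimpleGraph V) [Fintype V] [DecidableEq V]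
    [DecidableRel G.Adj] (c φ₀ : ℝ) (S : Finset V) : Prop :=
  (∃ v : V, IsSpreadingComponent G c φ₀ v S) ∧
    ∀ (w : V) (T : Finset V), IsSpreadingComponent G c φ₀ w T → S ⊆ T → S = T

/-- The kernel `K(v)`: the union of all maximal spreading components containing `v`. -/
def kernel (G : SimpleGraph V) [Fintype V] [DecidableEq V] [DecidableRel G.Adj]
    (c φ₀ : ℝ) (v : V) : Set V :=
  ⋃ S ∈ {S : Finset V | IsMaximalSpreadingComponent G c φ₀ S ∧ v ∈ S}, (S : Set V)

/-- The sunflower of `v`: the union of `K(v)` together with all maximal spreading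
components (for any vertex) intersecting `K(v)`. -/
def sunflower (G : SimpleGraph V) [Fintype V] [DecidableEq V] [DecidableRel G.Adj]
    (c φ₀ : ℝ) (v : V) : Set V :=
  kernel G c φ₀ v ∪
    ⋃ S ∈ {S : Finset V | IsMaximalSpreadingComponent G c φ₀ S ∧
        ((S : Set V) ∩ kernel G c φ₀ v).Nonempty}, (S : Set V)

section

variable [Fintype V] [DecidableEq V] {G : SimpleGraph V} [DecidableRel G.Adj] {c φ₀ : ℝ}

/-- Every spreading component is contained in a maximal one. -/
lemma IsSpreadingComponent.exists_maximal {v : V} {S : Finset V}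
    (hS : IsSpreadingComponent G c φ₀ v S) :
    ∃ T, IsMaximalSpreadingComponent G c φ₀ T ∧ S ⊆ T := by
  obtain ⟨T, hST, hT⟩ := Set.Finite.exists_le_maximal
    (Set.toFinite {T : Finset V | ∃ w, IsSpreadingComponent G c φ₀ w T}) ⟨v, hS⟩
  exact ⟨T, ⟨hT.prop, fun w U hU hTU => hTU.antisymm (hT.le_of_ge ⟨w, hU⟩ hTU)⟩, hST⟩

lemma IsMaximalSpreadingComponent.le_card {S : Finset V}
    (hS : IsMaximalSpreadingComponent G c φ₀ S) : (Fintype.card V : ℝ) / c ≤ S.card :=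
  let ⟨_, h⟩ := hS.1
  h.2.1

lemma mem_kernel {v x : V} :
    x ∈ kernel G c φ₀ v ↔ ∃ S, IsMaximalSpreadingComponent G c φ₀ S ∧ v ∈ S ∧ x ∈ S := by
  simp [kernel, and_assoc]

/-- A vertex whose kernel meets `K(w)` lies in the sunflower of `w`. -/
lemma mem_sunflower_of_not_disjoint {v w : V}
    (h : ¬ Disjoint (kernel G c φ₀ v) (kernel G c φ₀ w)) : v ∈ sunflower G c φ₀ w := by
  obtain ⟨x, hxv, hxw⟩ := Set.not_disjoint_iff.1 h
  obtain ⟨S, hS, hvS, hxS⟩ := mem_kernel.1 hxv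
  exact Or.inr (Set.mem_biUnion (⟨hS, x, hxS, hxw⟩ : _ ∧ _) hvS)

/-- A family of vertices with pairwise disjoint kernels, each containing a maximal spreading
component, has at most `c` members. -/
lemma card_le_of_pairwiseDisjoint_kernel (hc : 0 < c) {A : Finset V}
    (hmax : ∀ v ∈ A, ∃ S, IsMaximalSpreadingComponent G c φ₀ S ∧ v ∈ S)
    (hA : (A : Set V).PairwiseDisjoint (kernel G c φ₀)) : (A.card : ℝ) ≤ c := by
  rcases A.eq_empty_or_nonempty with rfl | ⟨a, -⟩
  · simpa using hc.le
  choose! S hS hvS using hmax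
  have hsub : ∀ v ∈ A, (S v : Set V) ⊆ kernel G c φ₀ v := fun v hv x hx =>
    mem_kernel.2 ⟨S v, hS v hv, hvS v hv, hx⟩
  have hdisj : (A : Set V).PairwiseDisjoint S := fun v hv w hw hvw =>
    Finset.disjoint_coe.1 ((hA hv hw hvw).mono (hsub v hv) (hsub w hw))
  have hcard : (A.card : ℝ) * (Fintype.card V / c) ≤ Fintype.card V := by
    calc (A.card : ℝ) * (Fintype.card V / c) = ∑ v ∈ A, (Fintype.card V / c : ℝ) := by simp
      _ ≤ ∑ v ∈ A, ((S v).card : ℝ) := Finset.sum_le_sum fun v hv => (hS v hv).le_card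
      _ = (A.biUnion S).card := by rw [Finset.card_biUnion hdisj]; push_cast; rfl
      _ ≤ Fintype.card V := by exact_mod_cast Finset.card_le_univ _
  have hn : (0 : ℝ) < Fintype.card V := by exact_mod_cast Fintype.card_pos_iff.2 ⟨a⟩
  rw [← mul_div_assoc, div_le_iff₀ hc, mul_comm] at hcard
  exact le_of_mul_le_mul_left hcard hn

end

/-- if every vertex of `G` has at least one spreading component (with
parameters `c ≥ 1` and `φ₀ > 0`), then there are vertices `v_1, …, v_j` with `j ≤ ⌊c⌋`
whose kernels are pairwise disjoint and whose sunflowers cover all of `V`. -/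
theorem sunflower_decomposition (G : SimpleGraph V) [Fintype V] [DecidableEq V]
    [DecidableRel G.Adj] (c φ₀ : ℝ) (hc : 1 ≤ c) (hφ₀ : 0 < φ₀)
    (hex : ∀ v : V, ∃ S : Finset V, IsSpreadingComponent G c φ₀ v S) :
    ∃ (j : ℕ) (vs : Fin j → V), j ≤ ⌊c⌋₊ ∧
      (∀ i i' : Fin j, i ≠ i' →
        Disjoint (kernel G c φ₀ (vs i)) (kernel G c φ₀ (vs i'))) ∧
      (⋃ i : Fin j, sunflower G c φ₀ (vs i)) = Set.univ := by
  have hmax : ∀ v : V, ∃ S, IsMaximalSpreadingComponent G c φ₀ S ∧ v ∈ S := fun v => by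
    obtain ⟨S, hS⟩ := hex v
    obtain ⟨T, hT, hST⟩ := hS.exists_maximal
    exact ⟨T, hT, hST hS.1⟩
  obtain ⟨A, -, hA⟩ := Set.Finite.exists_le_maximal
    (Set.toFinite {A : Finset V | (A : Set V).PairwiseDisjoint (kernel G c φ₀)})
    (a := ∅) (by simp)
  refine ⟨A.card, fun i => A.equivFin.symm i,
    Nat.le_floor (card_le_of_pairwiseDisjoint_kernel (by linarith) (fun v _ => hmax v) hA.prop),
    fun i j hij => hA.prop (A.equivFin.symm i).2 (A.equivFin.symm j).2 fun h =>
      hij (A.equivFin.symm.injective (Subtype.ext h)), Set.eq_univ_of_forall fun v => ?_⟩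
  suffices ∃ w ∈ A, v ∈ sunflower G c φ₀ w by
    obtain ⟨w, hw, hv⟩ := this
    exact Set.mem_iUnion.2 ⟨A.equivFin ⟨w, hw⟩, by simpa using hv⟩
  by_contra! hv
  have hdisj : ∀ w ∈ A, Disjoint (kernel G c φ₀ v) (kernel G c φ₀ w) := fun w hw =>
    not_not.1 fun h => hv w hw (mem_sunflower_of_not_disjoint h)
  have hins : (↑(insert v A) : Set V).PairwiseDisjoint (kernel G c φ₀) := by
    rw [Finset.coe_insert]
    exact hA.prop.insert fun w hw _ => hdisj w hw
  have hvA : v ∈ A := hA.le_of_ge hins (Finset.subset_insert v A) (Finset.mem_insert_self v A)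
  obtain ⟨S, hS, hvS⟩ := hmax v
  exact hv v hvA (Or.inl (mem_kernel.2 ⟨S, hS, hvS, hvS⟩))
end

section
/- For all integers c ≥ 2 and m ≥ 2, the c-barbell graph on n = cm vertices has conductance Φ ≤ 8c/n²: the cut whose one side is the union of the first ⌊c/2⌋ cliques has exactly one crossing edge, and both sides have volume at least n²/(8c), so its conductance is at most 8c/n². -/
open Finset

variable {V : Type*}

/-- The `c`-barbell graph on `n = c·m` vertices: `c` disjoint complete graphs
(`cliques`) `C_1, …, C_c`, each on `m` vertices (clique `i` is `{i} × Fin m`), plus,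
for each `1 ≤ i ≤ c − 1`, a single bridge edge joining the vertex `(i, 0)` of `C_i` to
the vertex `(i+1, 1)` of `C_{i+1}`; for `m ≥ 2` the two bridge endpoints inside any one
clique are distinct vertices. -/
def barbell (c m : ℕ) : SimpleGraph (Fin c × Fin m) :=
  SimpleGraph.fromRel (fun x y =>
    x.1 = y.1 ∨ ((x.1 : ℕ) + 1 = (y.1 : ℕ) ∧ (x.2 : ℕ) = 0 ∧ (y.2 : ℕ) = 1))

instance (c m : ℕ) : DecidableRel (barbell c m).Adj := fun x y => by
  unfold barbell
  exact decidable_of_iff _ (SimpleGraph.fromRel_adj _ x y).symm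

theorem barbell_adj_iff {c m : ℕ} (x y : Fin c × Fin m) :
    (barbell c m).Adj x y ↔ x ≠ y ∧
      ((x.1 = y.1 ∨ ((x.1 : ℕ) + 1 = (y.1 : ℕ) ∧ (x.2 : ℕ) = 0 ∧ (y.2 : ℕ) = 1)) ∨
        (y.1 = x.1 ∨ ((y.1 : ℕ) + 1 = (x.1 : ℕ) ∧ (y.2 : ℕ) = 0 ∧ (x.2 : ℕ) = 1))) :=
  SimpleGraph.fromRel_adj _ x y

theorem le_degIn_barbell {c m : ℕ} (x : Fin c × Fin m) :
    m - 1 ≤ degIn (barbell c m) univ x := by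
  have hsub : ({x.1} : Finset (Fin c)) ×ˢ univ.erase x.2 ⊆
      univ.filter (fun y => (barbell c m).Adj x y) := by
    rintro ⟨i, j⟩ hij
    simp only [mem_product, mem_singleton, mem_erase, mem_univ, and_true] at hij
    simp only [mem_filter, mem_univ, true_and, barbell_adj_iff]
    exact ⟨fun h => hij.2 (by rw [h]), Or.inl (Or.inl hij.1.symm)⟩
  simpa [degIn] using card_le_card hsub

theorem le_volIn_barbell {c m : ℕ} (U : Finset (Fin c × Fin m)) :
    U.card * (m - 1) ≤ volIn (barbell c m) univ U := by
  simpa [volIn] using card_nsmul_le_sum U _ _ fun x _ => le_degIn_barbell x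

theorem card_filter_fst_lt {c m k : ℕ} (hk : k ≤ c) :
    (univ.filter (fun x : Fin c × Fin m => (x.1 : ℕ) < k)).card = k * m := by
  have h : univ.filter (fun x : Fin c × Fin m => (x.1 : ℕ) < k) =
      univ.filter (fun i : Fin c => (i : ℕ) < k) ×ˢ univ := by
    ext x
    simp
  rw [h, card_product, Fin.card_filter_val_lt]
  simp [hk]

theorem cutIn_barbell_filter_fst_lt {c m k : ℕ} (hm : 2 ≤ m) (hk : 0 < k) (hkc : k < c) :
    cutIn (barbell c m) univ
      (univ.filter (fun x : Fin c × Fin m => (x.1 : ℕ) < k)) = 1 := by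
  rw [cutIn, card_eq_one]
  refine ⟨((⟨k - 1, by omega⟩, ⟨0, by omega⟩), (⟨k, hkc⟩, ⟨1, by omega⟩)), ?_⟩
  ext ⟨⟨⟨a, ha⟩, ⟨b, hb⟩⟩, ⟨⟨a', ha'⟩, ⟨b', hb'⟩⟩⟩
  simp only [mem_filter, mem_product, mem_sdiff, mem_univ, true_and, barbell_adj_iff,
    mem_singleton, Prod.mk.injEq, Fin.mk.injEq, ne_eq]
  omega

theorem sq_div_le_volIn_barbell {c m a : ℕ} (hc : 0 < c) (hm : 2 ≤ m) (ha : c ≤ 3 * a)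
    (U : Finset (Fin c × Fin m)) (hU : U.card = a * m) :
    ((c * m : ℕ) : ℝ) ^ 2 / (8 * (c : ℝ)) ≤ (volIn (barbell c m) univ U : ℝ) := by
  have hvol := le_volIn_barbell U
  rw [hU] at hvol
  have hm' : m ≤ 2 * (m - 1) := by omega
  have hprod : (c * m) * m ≤ (3 * a * m) * (2 * (m - 1)) := by gcongr
  have hnat : c * m * m ≤ 8 * volIn (barbell c m) univ U := by nlinarith
  have hreal : (c : ℝ) * m * m ≤ 8 * volIn (barbell c m) univ U := by exact_mod_cast hnat
  have hc' : (0 : ℝ) < c := by exact_mod_cast hc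
  rw [div_le_iff₀ (by positivity)]
  push_cast
  nlinarith [mul_le_mul_of_nonneg_left hreal hc'.le]

theorem phiIn_nonneg (G : SimpleGraph V) [DecidableEq V] [DecidableRel G.Adj]
    (S U : Finset V) : 0 ≤ phiIn G S U := by
  unfold phiIn
  positivity

theorem conductance_le_phiIn (G : SimpleGraph V) [Fintype V] [DecidableEq V]
    [DecidableRel G.Adj] {U : Finset V} (hU : U.Nonempty) (hU' : U ⊂ univ) :
    conductance G ≤ phiIn G univ U := by
  refine csInf_le ⟨0, ?_⟩ ⟨U, hU, hU', rfl⟩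
  rintro _ ⟨W, -, -, rfl⟩
  exact phiIn_nonneg G univ W

/-- for integers `c ≥ 2`, `m ≥ 2` and `n = c·m`, in the `c`-barbell graph,
the cut whose one side `S` is the union of the first `⌊c/2⌋` cliques has exactly one
crossing edge, both sides have volume at least `n²/(8c)`, so its conductance is at most
`8c/n²`; hence `Φ ≤ 8c/n²`. -/
theorem barbell_conductance_le (c m n : ℕ) (hc : 2 ≤ c) (hm : 2 ≤ m) (hn : n = c * m) :
    cutIn (barbell c m) Finset.univ
        (Finset.univ.filter (fun x : Fin c × Fin m => (x.1 : ℕ) < c / 2)) = 1 ∧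
    ((n : ℝ) ^ 2 / (8 * (c : ℝ)) ≤
      (volIn (barbell c m) Finset.univ
        (Finset.univ.filter (fun x : Fin c × Fin m => (x.1 : ℕ) < c / 2)) : ℝ)) ∧
    ((n : ℝ) ^ 2 / (8 * (c : ℝ)) ≤
      (volIn (barbell c m) Finset.univ
        (Finset.univ \ Finset.univ.filter (fun x : Fin c × Fin m => (x.1 : ℕ) < c / 2)) : ℝ)) ∧
    phiIn (barbell c m) Finset.univ
        (Finset.univ.filter (fun x : Fin c × Fin m => (x.1 : ℕ) < c / 2))
      ≤ 8 * (c : ℝ) / (n : ℝ) ^ 2 ∧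
    conductance (barbell c m) ≤ 8 * (c : ℝ) / (n : ℝ) ^ 2 := by
  subst hn
  have hcut := cutIn_barbell_filter_fst_lt (c := c) (k := c / 2) hm (by omega) (by omega)
  have hcard := card_filter_fst_lt (m := m) (Nat.div_le_self c 2)
  set U := Finset.univ.filter (fun x : Fin c × Fin m => (x.1 : ℕ) < c / 2)
  have hcard' : (univ \ U).card = (c - c / 2) * m := by
    rw [card_sdiff_of_subset (subset_univ U), hcard, Nat.sub_mul]
    simp
  have hvol := sq_div_le_volIn_barbell (by omega) hm (by omega) U hcard
  have hvol' := sq_div_le_volIn_barbell (by omega) hm (by omega) (univ \ U) hcard'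
  have hphi : phiIn (barbell c m) univ U ≤ 8 * (c : ℝ) / ((c * m : ℕ) : ℝ) ^ 2 := by
    have hpos : (0 : ℝ) < ((c * m : ℕ) : ℝ) ^ 2 / (8 * (c : ℝ)) := by
      have : 0 < c := by omega
      have : 0 < m := by omega
      positivity
    rw [phiIn, hcut, Nat.cast_one, Nat.cast_min, ← one_div_div (_ ^ 2)]
    exact one_div_le_one_div_of_le hpos (le_min hvol hvol')
  have hne : U.Nonempty := by
    rw [← card_pos, hcard]
    exact Nat.mul_pos (by omega) (by omega)
  have hne' : (univ \ U).Nonempty := by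
    rw [← card_pos, hcard']
    exact Nat.mul_pos (by omega) (by omega)
  have hss : U ⊂ univ := by
    obtain ⟨x, hx⟩ := hne'
    exact (ssubset_iff_of_subset (subset_univ U)).2 ⟨x, mem_univ x, (mem_sdiff.1 hx).2⟩
  exact ⟨hcut, hvol, hvol', hphi, (conductance_le_phiIn _ hne hss).trans hphi⟩
end

section
/- Let T be a finite tree (a connected acyclic simple graph) and let D be a dominating set of T with |D| = X ≥ 1. Then the diameter of T is at most 3X − 1. -/
/-- In a connected graph, every natural number up to `G.dist u v` is the distance from `u` to some
vertex. -/
theorem SimpleGraph.Connected.exists_dist_eq_of_le_dist {V : Type*} {G : SimpleGraph V}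
    (hG : G.Connected) {u v : V} {k : ℕ} (hk : k ≤ G.dist u v) : ∃ w, G.dist u w = k := by
  obtain ⟨p, hp⟩ := hG.exists_walk_length_eq_dist u v
  refine ⟨p.getVert k, ?_⟩
  have h₁ := SimpleGraph.dist_le (p.take k)
  have h₂ := SimpleGraph.dist_le (p.drop k)
  have h₃ := hG.dist_triangle (u := u) (v := p.getVert k) (w := v)
  rw [SimpleGraph.Walk.take_length] at h₁
  rw [SimpleGraph.Walk.drop_length] at h₂
  omega

/-- In a connected graph, a finite dominating set `D` satisfies `G.dist u v + 1 ≤ 3 * |D|` for all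
vertices `u` and `v`. -/
theorem SimpleGraph.Connected.dist_add_one_le_three_mul_card {V : Type*} {G : SimpleGraph V}
    (hG : G.Connected) {D : Finset V} (hD : ∀ v, v ∈ D ∨ ∃ d ∈ D, G.Adj d v) (u v : V) :
    G.dist u v + 1 ≤ 3 * D.card := by
  have hsub : Finset.range (G.dist u v + 1) ⊆
      D.biUnion fun d ↦ Finset.Icc (G.dist u d - 1) (G.dist u d + 1) := by
    intro k hk
    obtain ⟨w, rfl⟩ := hG.exists_dist_eq_of_le_dist (Finset.mem_range_succ_iff.mp hk)
    rw [Finset.mem_biUnion]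
    obtain hw | ⟨d, hd, hadj⟩ := hD w
    · exact ⟨w, hw, by simp⟩
    · refine ⟨d, hd, Finset.mem_Icc.mpr ?_⟩
      have h₁ := hG.dist_triangle (u := u) (v := d) (w := w)
      have h₂ := hG.dist_triangle (u := u) (v := w) (w := d)
      rw [SimpleGraph.dist_eq_one_iff_adj.mpr hadj] at h₁
      rw [SimpleGraph.dist_eq_one_iff_adj.mpr hadj.symm] at h₂
      omega
  calc G.dist u v + 1 = (Finset.range (G.dist u v + 1)).card := (Finset.card_range _).symm
    _ ≤ _ := Finset.card_le_card hsub
    _ ≤ D.card * 3 := Finset.card_biUnion_le_card_mul _ _ _ fun d _ ↦ by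
      rw [Nat.card_Icc]; omega
    _ = 3 * D.card := Nat.mul_comm _ _

/-- if `T` is a finite tree (connected acyclic simple graph) and `D` is a
dominating set of `T` with `|D| = X ≥ 1`, then the diameter of `T` is at most `3X − 1`,
i.e. any two vertices are at distance at most `3X − 1`. -/
theorem tree_diam_le_of_dominating {V : Type*} [Fintype V] (T : SimpleGraph V)
    (hconn : T.Connected) (hacyclic : T.IsAcyclic)
    (D : Finset V) (hdom : ∀ v : V, v ∈ D ∨ ∃ d ∈ D, T.Adj d v)
    (X : ℕ) (hX : D.card = X) (hX1 : 1 ≤ X) :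
    ∀ u v : V, T.dist u v ≤ 3 * X - 1 := by
  intro u v
  have h := hconn.dist_add_one_le_three_mul_card hdom u v
  omega
end

section
/- Let T be a finite tree and let P be a path in T, i.e., a sequence of distinct vertices of T in which consecutive vertices are adjacent. Then for every vertex u of T, the number of vertices w appearing on P such that w = u or w is adjacent to u is at most 3. -/
namespace SimpleGraph

/-- In an acyclic graph, a path is no longer than any walk with the same ends. -/
theorem IsAcyclic.length_le_of_isPath {V : Type*} {T : SimpleGraph V} (hT : T.IsAcyclic)
    {a b : V} {p : T.Walk a b} (hp : p.IsPath) (q : T.Walk a b) : p.length ≤ q.length := by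
  classical
  have h := congrArg Subtype.val
    ((hT.subsingleton_path a b).elim ⟨p, hp⟩ ⟨q.bypass, q.bypass_isPath⟩)
  have h' : p = q.bypass := h
  rw [h']
  exact q.length_bypass_le_length

/-- Two vertices dominated by a common vertex are joined by a walk of length at most two. -/
theorem exists_walk_length_le_two {V : Type*} {T : SimpleGraph V} {u v w : V}
    (hv : v = u ∨ T.Adj u v) (hw : w = u ∨ T.Adj u w) : ∃ q : T.Walk v w, q.length ≤ 2 := by
  rcases hv with rfl | hv <;> rcases hw with rfl | hw
  · exact ⟨.nil, by simp⟩
  · exact ⟨.cons hw .nil, by simp⟩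
  · exact ⟨.cons hv.symm .nil, by simp⟩
  · exact ⟨.cons hv.symm (.cons hw .nil), by simp⟩

end SimpleGraph

/-- let `T` be a finite tree and `P` a path in `T` (a walk visiting
pairwise distinct vertices). Then for every vertex `u` of `T`, the number of vertices
`w` appearing on `P` with `w = u` or `w` adjacent to `u` is at most `3`. -/
theorem tree_path_dominated_le_three {V : Type*} [Fintype V] [DecidableEq V]
    (T : SimpleGraph V) [DecidableRel T.Adj]
    (hconn : T.Connected) (hacyclic : T.IsAcyclic)
    {a b : V} (P : T.Walk a b) (hP : P.IsPath) (u : V) :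
    (P.support.filter (fun w => w = u ∨ T.Adj u w)).length ≤ 3 := by
  induction P with
  | nil => exact (List.length_filter_le _ _).trans (by simp)
  | @cons a c b h p ih =>
    by_cases ha : a = u ∨ T.Adj u a
    · have hdrop : (((SimpleGraph.Walk.cons h p).support.drop 3).filter
          (fun w => w = u ∨ T.Adj u w)) = [] := by
        simp only [List.filter_eq_nil_iff, decide_eq_true_eq]
        intro w hw hwu
        obtain ⟨i, hi, rfl⟩ := List.mem_iff_getElem.mp hw
        rw [List.length_drop, SimpleGraph.Walk.length_support] at hi
        rw [List.getElem_drop, ← SimpleGraph.Walk.getVert_eq_support_getElem _ (by omega)] at hwu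
        obtain ⟨q, hq⟩ := SimpleGraph.exists_walk_length_le_two ha hwu
        have hle := hacyclic.length_le_of_isPath (hP.take (3 + i)) q
        rw [SimpleGraph.Walk.take_length] at hle
        omega
      rw [← List.take_append_drop 3 (SimpleGraph.Walk.cons h p).support, List.filter_append,
        hdrop, List.append_nil]
      exact (List.length_filter_le _ _).trans (List.length_take_le _ _)
    · rw [SimpleGraph.Walk.support_cons, List.filter_cons_of_neg (by simpa using ha)]
      exact ih hP.of_cons
end

section
/- Let V be a finite set, R ⊆ V a set of roots, p : V → V a parent function, and r, t : V → ℕ functions (interpreted as the highest rumor received and the time of its reception). Assume that for every v ∈ V ∖ R, either r(p(v)) > r(v), or r(p(v)) = r(v) and t(p(v)) < t(v). Then the simple graph on V whose edge set is { {v, p(v)} : v ∈ V ∖ R } is acyclic (a forest). -/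
/-- A graph whose edges join vertices to their parents is acyclic if a function to a linear order
strictly increases along each parent edge. -/
theorem SimpleGraph.isAcyclic_fromRel_of_lt_parent {V α : Type*} [LinearOrder α]
    (s : Set V) (p : V → V) (f : V → α) (hf : ∀ v ∈ s, f v < f (p v)) :
    (SimpleGraph.fromRel (fun a b => a ∈ s ∧ p a = b)).IsAcyclic := by
  classical
  intro u c hc
  obtain ⟨m, hm, hmin⟩ := c.support.toFinset.exists_min_image f ⟨u, by simp⟩
  rw [List.mem_toFinset] at hm
  have eq_parent : ∀ x ∈ c.support,
      (SimpleGraph.fromRel (fun a b => a ∈ s ∧ p a = b)).Adj m x → x = p m := by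
    intro x hx hadj
    rw [SimpleGraph.fromRel_adj] at hadj
    rcases hadj.2 with ⟨_, h⟩ | ⟨hxs, rfl⟩
    · exact h.symm
    · exact absurd (hf x hxs) (hmin x (List.mem_toFinset.mpr hx)).not_gt
  have hc' := hc.rotate hm
  have hmem : ∀ x ∈ (c.rotate m hm).support, x ∈ c.support := fun x hx =>
    (c.mem_support_rotate_iff m hm).mp hx
  exact hc'.snd_ne_penultimate <|
    (eq_parent _ (hmem _ (SimpleGraph.Walk.getVert_mem_support _ _))
      (SimpleGraph.Walk.adj_snd hc'.not_nil)).trans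
    (eq_parent _ (hmem _ (SimpleGraph.Walk.getVert_mem_support _ _))
      (SimpleGraph.Walk.adj_penultimate hc'.not_nil).symm).symm

/-- let `V` be a finite set, `R ⊆ V` a set of roots, `p : V → V` a parent
function, and `r, t : V → ℕ` (the highest rumor received and the time of its reception).
If for every `v ∉ R`, either `r (p v) > r v`, or `r (p v) = r v` and `t (p v) < t v`,
then the simple graph on `V` whose edges are the pairs `{v, p v}` for `v ∉ R` is
acyclic (a forest). -/
theorem parent_edges_acyclic {V : Type*} [Fintype V] [DecidableEq V]
    (R : Finset V) (p : V → V) (r t : V → ℕ)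
    (h : ∀ v : V, v ∉ R → r (p v) > r v ∨ (r (p v) = r v ∧ t (p v) < t v)) :
    (SimpleGraph.fromRel (fun a b => a ∉ R ∧ p a = b)).IsAcyclic := by
  refine SimpleGraph.isAcyclic_fromRel_of_lt_parent {v | v ∉ R} p
    (fun v => toLex (r v, OrderDual.toDual (t v))) fun v hv => ?_
  rw [Prod.Lex.toLex_lt_toLex]
  exact (h v hv).imp id fun ⟨hr, ht⟩ => ⟨hr.symm, OrderDual.toDual_lt_toDual.mpr ht⟩
end

section
/- Let V be a finite linearly ordered set and G = (V,E) a simple graph. For each vertex v define the incidence vector i_v, assigning to each pair (u,w) with u < w the value: 1 if {u,w} ∈ E and v = u; −1 if {u,w} ∈ E and v = w; and 0 otherwise. Then for every subset S ⊆ V and every pair u < w, the sum Σ_{v ∈ S} i_v has a nonzero entry at (u,w) if and only if {u,w} ∈ E and exactly one of u, w belongs to S; moreover, in that case the entry equals 1 or −1. -/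
open Finset

/-- The signed incidence vector of a vertex `v`, indexed by pairs `(u,w)` of vertices:
its entry at a pair `(u,w)` with `u < w` is `1` if `{u,w}` is an edge and `v = u`,
`−1` if `{u,w}` is an edge and `v = w`, and `0` otherwise; entries at pairs not
satisfying `u < w` are `0`. -/
def incVec {V : Type*} [LinearOrder V] (G : SimpleGraph V) [DecidableRel G.Adj]
    (v : V) (e : V × V) : ℤ :=
  if e.1 < e.2 ∧ G.Adj e.1 e.2 then
    (if v = e.1 then 1 else if v = e.2 then -1 else 0)
  else 0

/-- The entry at `(u, w)` of the sum of the incidence vectors over `S` is the difference of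
the indicators of `u ∈ S` and `w ∈ S` on edges, and `0` off edges. -/
theorem sum_incVec_apply {V : Type*} [LinearOrder V] (G : SimpleGraph V) [DecidableRel G.Adj]
    (S : Finset V) {u w : V} (huw : u < w) :
    ∑ v ∈ S, incVec G v (u, w) =
      if G.Adj u w then (if u ∈ S then 1 else 0) - (if w ∈ S then 1 else 0) else 0 := by
  have entry (v : V) : incVec G v (u, w) =
      if G.Adj u w then (if v = u then 1 else 0) - (if v = w then 1 else 0) else 0 := by
    have := huw.ne
    unfold incVec
    grind
  simp only [entry]
  split_ifs <;> simp_all [Finset.sum_sub_distrib]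

/-- for every subset `S ⊆ V` and every pair `u < w`, the sum
`Σ_{v ∈ S} i_v` has a nonzero entry at `(u,w)` if and only if `{u,w} ∈ E` and exactly
one of `u, w` belongs to `S`; moreover, in that case the entry equals `1` or `−1`. -/
theorem incVec_sum_support {V : Type*} [Fintype V] [LinearOrder V]
    (G : SimpleGraph V) [DecidableRel G.Adj] (S : Finset V) (u w : V) (huw : u < w) :
    ((∑ v ∈ S, incVec G v (u, w)) ≠ 0 ↔ (G.Adj u w ∧ Xor' (u ∈ S) (w ∈ S))) ∧
    (G.Adj u w → Xor' (u ∈ S) (w ∈ S) →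
      (∑ v ∈ S, incVec G v (u, w)) = 1 ∨ (∑ v ∈ S, incVec G v (u, w)) = -1) := by
  rw [sum_incVec_apply G S huw]
  by_cases h : G.Adj u w <;> by_cases hu : u ∈ S <;> by_cases hw : w ∈ S <;>
    simp [h, hu, hw, Xor']
end
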